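/- Let n be an even positive integer and let k be the largest integer such that 2^k divides n. Then r_3(n) = 6·(3 − k)·d(n/2^k) − 4·Σ (−1)^{r+s+t}, where the sum is over ordered triples of positive integers (r,s,t) with rs + rt + st = n and d(m) denotes the number of positive divisors of m. -/

import Mathlib

/-- `r₃ n` is the number of ordered triples `(x,y,z) ∈ ℤ³` with `x² + y² + z² = n`. -/
noncomputable def r3 (n : ℕ) : ℕ :=
  Set.ncard {v : ℤ × ℤ × ℤ | v.1 ^ 2 + v.2.1 ^ 2 + v.2.2 ^ 2 = (n : ℤ)}

section

open Function Set

/-- The sign `(-1)^x` for an integer `x`. -/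
def altSign (x : ℤ) : ℤ := if Even x then 1 else -1

/-- The weight of a triple: `4` if all entries are positive, `2` if exactly one entry is zero and
the other two are positive, and `0` otherwise. -/
def tripleWeight (r s t : ℤ) : ℤ :=
  if 0 < r ∧ 0 < s ∧ 0 < t then 4
  else if 0 ≤ r ∧ 0 ≤ s ∧ 0 ≤ t ∧ 0 < r + s ∧ 0 < r + t ∧ 0 < s + t then 2 else 0

theorem altSign_add (x y : ℤ) : altSign (x + y) = altSign x * altSign y := by
  unfold altSign
  by_cases hx : Even x <;> by_cases hy : Even y <;> simp [Int.even_add, hx, hy]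

theorem altSign_neg (x : ℤ) : altSign (-x) = altSign x := by simp [altSign]

theorem altSign_one : altSign 1 = -1 := by decide

theorem altSign_sq (x : ℤ) : altSign (x ^ 2) = altSign x := by
  simp [altSign, Int.even_pow]

theorem altSign_congr {x y : ℤ} (h : Even (x - y)) : altSign x = altSign y := by
  unfold altSign
  simp only [Int.even_sub.1 h]

theorem altSign_natCast (m : ℕ) : altSign (m : ℤ) = (-1) ^ m := by
  unfold altSign
  by_cases h : Even m
  · simp [h]
  · rw [Nat.not_even_iff_odd] at h
    simp [h]

theorem tripleWeight_swap_right (r s t : ℤ) : tripleWeight r s t = tripleWeight r t s := by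
  unfold tripleWeight
  split_ifs <;> first | rfl | omega

theorem tripleWeight_swap_left (r s t : ℤ) : tripleWeight r s t = tripleWeight s r t := by
  unfold tripleWeight
  split_ifs <;> first | rfl | omega

theorem tripleWeight_nonneg {r s t : ℤ} (h : tripleWeight r s t ≠ 0) :
    0 ≤ r ∧ 0 ≤ s ∧ 0 ≤ t ∧ 0 < r + s ∧ 0 < r + t ∧ 0 < s + t := by
  unfold tripleWeight at h
  split_ifs at h <;> omega

/-- A function that changes sign under an involution of a set containing its support sums to `0`. -/
theorem finsum_ite_eq_zero_of_invol {α : Type*} (P : α → Prop) [DecidablePred P] (f : α → ℤ)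
    (e : α → α) (hP : ∀ x, P x → P (e x)) (he : ∀ x, P x → e (e x) = x)
    (hf : ∀ x, P x → f (e x) = -f x) : ∑ᶠ x, (if P x then f x else 0) = 0 := by
  have h1 : ∑ᶠ x, (if P x then f x else 0) = ∑ᶠ x ∈ {x | P x}, f x := by
    refine finsum_congr fun x => ?_
    by_cases hx : P x <;> simp [hx]
  have h2 : ∑ᶠ x ∈ {x | P x}, f x = ∑ᶠ x ∈ {x | P x}, -f x := by
    refine finsum_mem_eq_of_bijOn e ⟨hP, ?_, ?_⟩ fun x hx => by simp [hf x hx]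
    · intro x hx y hy hxy
      rw [← he x hx, ← he y hy, hxy]
    · intro x hx
      exact ⟨e x, hP x hx, he x hx⟩
  have h3 : ∑ᶠ x ∈ {x | P x}, -f x = -∑ᶠ x ∈ {x | P x}, f x := by
    rw [← finsum_neg_distrib]
    refine finsum_congr fun x => ?_
    by_cases hx : P x <;> simp [hx]
  omega

/-- Change of variables along an injective map whose range contains the support. -/
theorem finsum_comp_of_injective {α β : Type*} (g : α → β) (hg : Injective g) (f : β → ℤ)
    (hf : ∀ y, f y ≠ 0 → ∃ x, g x = y) : ∑ᶠ y, f y = ∑ᶠ x, f (g x) := by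
  rw [← finsum_mem_range hg]
  refine finsum_congr fun y => ?_
  by_cases hy : y ∈ range g
  · simp only [hy, finsum_true]
  · have : f y = 0 := by
      by_contra h
      exact hy (hf y h)
    simp [this]

theorem hasFiniteSupport_of_bound₃ (f : ℤ × ℤ × ℤ → ℤ) (N : ℤ)
    (h : ∀ x y z, f (x, y, z) ≠ 0 → (-N ≤ x ∧ x ≤ N) ∧ (-N ≤ y ∧ y ≤ N) ∧ (-N ≤ z ∧ z ≤ N)) :
    HasFiniteSupport f := by
  refine ((finite_Icc (-N) N).prod ((finite_Icc (-N) N).prod (finite_Icc (-N) N))).subset ?_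
  rintro ⟨x, y, z⟩ hx
  obtain ⟨h1, h2, h3⟩ := h x y z hx
  exact ⟨h1, h2, h3⟩

theorem hasFiniteSupport_of_bound₄ (f : ℤ × ℤ × ℤ × ℤ → ℤ) (N : ℤ)
    (h : ∀ w x y z, f (w, x, y, z) ≠ 0 →
      (-N ≤ w ∧ w ≤ N) ∧ (-N ≤ x ∧ x ≤ N) ∧ (-N ≤ y ∧ y ≤ N) ∧ (-N ≤ z ∧ z ≤ N)) :
    HasFiniteSupport f := by
  refine ((finite_Icc (-N) N).prod ((finite_Icc (-N) N).prod
    ((finite_Icc (-N) N).prod (finite_Icc (-N) N)))).subset ?_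
  rintro ⟨w, x, y, z⟩ hx
  obtain ⟨h0, h1, h2, h3⟩ := h w x y z hx
  exact ⟨h0, h1, h2, h3⟩

/-- Sum over one period of the lattice points on a line cancels under `v ↦ -v`. -/
theorem finsum_window_eq_zero (n u e : ℤ) :
    ∑ᶠ p : ℤ × ℤ × ℤ, (if (-u < p.1 ∧ p.1 < u) ∧ (e ≤ p.2.2 ∧ p.2.2 < u + p.1 + e) ∧
      p.2.1 * (u + p.1) + p.2.2 * (u - p.1) = n - p.1 ^ 2
      then 2 * altSign (p.2.1 + p.2.2) * p.1 else 0) = 0 := by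
  refine finsum_ite_eq_zero_of_invol (fun p : ℤ × ℤ × ℤ => (-u < p.1 ∧ p.1 < u) ∧
      (e ≤ p.2.2 ∧ p.2.2 < u + p.1 + e) ∧
      p.2.1 * (u + p.1) + p.2.2 * (u - p.1) = n - p.1 ^ 2) _
    (fun p => (-p.1, p.2.2 + (p.2.1 - e) / (u - p.1) * (u + p.1),
      (p.2.1 - e) % (u - p.1) + e)) ?_ ?_ ?_
  · rintro ⟨v, s, t⟩ ⟨⟨h1, h2⟩, ⟨h3, h4⟩, h5⟩
    simp only at *
    have hp : 0 < u - v := by omega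
    have ha := Int.emod_nonneg (s - e) hp.ne'
    have hb := Int.emod_lt_of_pos (s - e) hp
    have hc := Int.emod_add_mul_ediv (s - e) (u - v)
    refine ⟨by omega, by constructor <;> linarith, ?_⟩
    linear_combination h5 + (u + v) * hc
  · rintro ⟨v, s, t⟩ ⟨⟨h1, h2⟩, ⟨h3, h4⟩, h5⟩
    simp only at *
    have hp : 0 < u - v := by omega
    have hq : 0 < u + v := by omega
    have hc := Int.emod_add_mul_ediv (s - e) (u - v)
    have e1 : t + (s - e) / (u - v) * (u + v) - e = (t - e) + (s - e) / (u - v) * (u + v) := by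
      ring
    have e2 : (t - e) % (u + v) = t - e := Int.emod_eq_of_lt (by omega) (by omega)
    have e3 : (t - e) / (u + v) = 0 := Int.ediv_eq_zero_of_lt (by omega) (by omega)
    simp only [Prod.mk.injEq, neg_neg, true_and, sub_neg_eq_add, e1, Int.add_mul_emod_self_right,
      Int.add_mul_ediv_right _ _ hq.ne', e2, e3]
    constructor
    · linear_combination hc
    · ring
  · rintro ⟨v, s, t⟩ -
    simp only
    have hc := Int.emod_add_mul_ediv (s - e) (u - v)
    rw [altSign_congr (x := t + (s - e) / (u - v) * (u + v) + ((s - e) % (u - v) + e)) (y := s + t)]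
    · ring
    · refine ⟨(s - e) / (u - v) * v, ?_⟩
      linear_combination hc

theorem finsum_weighted_line_eq_zero_of_gt {n u : ℤ} (h : n < u ^ 2) :
    ∑ᶠ p : ℤ × ℤ × ℤ, (if (-u < p.1 ∧ p.1 < u) ∧ (0 ≤ p.2.1 ∧ 0 ≤ p.2.2) ∧
      p.2.1 * (u + p.1) + p.2.2 * (u - p.1) = n - p.1 ^ 2
      then altSign (p.2.1 + p.2.2) * tripleWeight (u + p.1 - p.2.2) p.2.1 p.2.2 * p.1 else 0)
      = 0 := by
  refine finsum_ite_eq_zero_of_invol (fun p : ℤ × ℤ × ℤ => (-u < p.1 ∧ p.1 < u) ∧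
      (0 ≤ p.2.1 ∧ 0 ≤ p.2.2) ∧
      p.2.1 * (u + p.1) + p.2.2 * (u - p.1) = n - p.1 ^ 2) _
    (fun p => (-p.1, p.2.2, p.2.1)) ?_ ?_ ?_
  · rintro ⟨v, s, t⟩ ⟨⟨h1, h2⟩, ⟨h3, h4⟩, h5⟩
    simp only at *
    exact ⟨by omega, ⟨h4, h3⟩, by linear_combination h5⟩
  · rintro ⟨v, s, t⟩ -
    simp
  · rintro ⟨v, s, t⟩ ⟨⟨h1, h2⟩, ⟨h3, h4⟩, h5⟩
    simp only at *
    have hr : 0 < u + v - t := by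
      by_contra hc
      nlinarith [mul_nonneg h3 (by omega : 0 ≤ u + v),
        mul_nonneg (by omega : 0 ≤ t - (u + v)) (by omega : 0 ≤ u - v)]
    have hr' : 0 < u + -v - s := by
      by_contra hc
      nlinarith [mul_nonneg h4 (by omega : 0 ≤ u - v),
        mul_nonneg (by omega : 0 ≤ s - (u - v)) (by omega : 0 ≤ u + v)]
    have hw : tripleWeight (u + -v - s) t s = tripleWeight (u + v - t) s t := by
      unfold tripleWeight
      split_ifs <;> first | rfl | omega
    rw [hw, add_comm t s]
    ring

theorem finsum_weighted_line_eq_zero_of_eq (u : ℤ) :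
    ∑ᶠ p : ℤ × ℤ × ℤ, (if (-u < p.1 ∧ p.1 < u) ∧ (0 ≤ p.2.1 ∧ 0 ≤ p.2.2) ∧
      p.2.1 * (u + p.1) + p.2.2 * (u - p.1) = u ^ 2 - p.1 ^ 2
      then altSign (p.2.1 + p.2.2) * tripleWeight (u + p.1 - p.2.2) p.2.1 p.2.2 * p.1 else 0)
      = 0 := by
  have key : ∀ v s t : ℤ, (-u < v ∧ v < u) → (0 ≤ s ∧ 0 ≤ t) →
      s * (u + v) + t * (u - v) = u ^ 2 - v ^ 2 → 0 ≤ u + v - t ∧ 0 ≤ u - v - s ∧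
      (s = 0 ↔ u + v - t = 0) ∧ (t = 0 ↔ u - v - s = 0) := by
    rintro v s t ⟨h1, h2⟩ ⟨h3, h4⟩ h5
    have hp : 0 < u - v := by omega
    have hq : 0 < u + v := by omega
    have e1 : (u + v - t) * (u - v) = s * (u + v) := by linear_combination -h5
    have e2 : (u - v - s) * (u + v) = t * (u - v) := by linear_combination -h5
    refine ⟨?_, ?_, ⟨?_, ?_⟩, ⟨?_, ?_⟩⟩
    · by_contra hc
      nlinarith [mul_nonneg h3 hq.le]
    · by_contra hc
      nlinarith [mul_nonneg h4 hp.le]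
    · rintro rfl
      rw [zero_mul] at e1
      exact (mul_eq_zero.1 e1).resolve_right hp.ne'
    · intro h
      rw [h, zero_mul] at e1
      exact (mul_eq_zero.1 e1.symm).resolve_right hq.ne'
    · rintro rfl
      rw [zero_mul] at e2
      exact (mul_eq_zero.1 e2).resolve_right hq.ne'
    · intro h
      rw [h, zero_mul] at e2
      exact (mul_eq_zero.1 e2.symm).resolve_right hp.ne'
  refine finsum_ite_eq_zero_of_invol (fun p : ℤ × ℤ × ℤ => (-u < p.1 ∧ p.1 < u) ∧
      (0 ≤ p.2.1 ∧ 0 ≤ p.2.2) ∧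
      p.2.1 * (u + p.1) + p.2.2 * (u - p.1) = u ^ 2 - p.1 ^ 2) _
    (fun p => if p.2.2 = 0 then (-p.1, u + p.1, 0) else if p.2.1 = 0 then p
      else (-p.1, p.2.2, p.2.1)) ?_ ?_ ?_
  · rintro ⟨v, s, t⟩ ⟨⟨h1, h2⟩, ⟨h3, h4⟩, h5⟩
    simp only at *
    split_ifs with ht hs
    · exact ⟨by simp only; omega, by simp only; omega, by simp only; ring⟩
    · exact ⟨⟨h1, h2⟩, ⟨h3, h4⟩, h5⟩
    · exact ⟨by simp only; omega, ⟨h4, h3⟩, by simp only; linear_combination h5⟩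
  · rintro ⟨v, s, t⟩ ⟨hv, hst, h5⟩
    obtain ⟨k1, k2, k3, k4⟩ := key v s t hv hst h5
    simp only at *
    by_cases ht : t = 0
    · have := k4.1 ht
      simp only [ht, if_true, neg_neg, Prod.mk.injEq, true_and, and_true]
      omega
    · by_cases hs : s = 0
      · simp [hs, ht]
      · simp [hs, ht]
  · rintro ⟨v, s, t⟩ ⟨hv, hst, h5⟩
    obtain ⟨k1, k2, k3, k4⟩ := key v s t hv hst h5
    simp only at *
    by_cases ht : t = 0
    · have hs := k4.1 ht
      have hs' : s = u - v := by omega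
      subst ht hs'
      simp only [if_true]
      have w1 : tripleWeight (u + -v - 0) (u + v) 0 = 2 := by
        unfold tripleWeight
        rw [if_neg (by omega), if_pos (by omega)]
      have w2 : tripleWeight (u + v - 0) (u - v) 0 = 2 := by
        unfold tripleWeight
        rw [if_neg (by omega), if_pos (by omega)]
      rw [w1, w2, altSign_congr (x := u + v + 0) (y := u - v + 0) ⟨v, by ring⟩]
      ring
    · by_cases hs : s = 0
      · have w : tripleWeight (u + v - t) s t = 0 := by
          unfold tripleWeight
          rw [if_neg (by omega), if_neg (by omega)]
        simp only [ht, hs, if_true, if_false]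
        rw [← hs, w]
        ring
      · have w1 : tripleWeight (u + -v - s) t s = 4 := by
          unfold tripleWeight
          rw [if_pos (by omega)]
        have w2 : tripleWeight (u + v - t) s t = 4 := by
          unfold tripleWeight
          rw [if_pos (by omega)]
        simp only [ht, hs, if_false]
        rw [w1, w2, add_comm t s]
        ring

theorem finsum_weighted_line_eq_zero_of_lt {n u : ℤ} (h : u ^ 2 < n) :
    ∑ᶠ p : ℤ × ℤ × ℤ, (if (-u < p.1 ∧ p.1 < u) ∧ (0 ≤ p.2.1 ∧ 0 ≤ p.2.2) ∧
      p.2.1 * (u + p.1) + p.2.2 * (u - p.1) = n - p.1 ^ 2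
      then altSign (p.2.1 + p.2.2) * tripleWeight (u + p.1 - p.2.2) p.2.1 p.2.2 * p.1 else 0)
      = 0 := by
  have hs_pos : ∀ v s t : ℤ, (-u < v ∧ v < u) → t ≤ u + v →
      s * (u + v) + t * (u - v) = n - v ^ 2 → 0 < s := by
    intro v s t hv ht h5
    by_contra hc
    nlinarith [mul_nonneg (by omega : 0 ≤ u + v - t) (by omega : 0 ≤ u - v),
      mul_nonneg (by omega : 0 ≤ -s) (by omega : 0 ≤ u + v)]
  have hfin : ∀ e : ℤ, 0 ≤ e → e ≤ 1 → HasFiniteSupport fun p : ℤ × ℤ × ℤ =>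
      (if (-u < p.1 ∧ p.1 < u) ∧ (e ≤ p.2.2 ∧ p.2.2 < u + p.1 + e) ∧
      p.2.1 * (u + p.1) + p.2.2 * (u - p.1) = n - p.1 ^ 2
      then 2 * altSign (p.2.1 + p.2.2) * p.1 else 0) := by
    intro e he0 he1
    refine hasFiniteSupport_of_bound₃ _ (n + 2 * u) ?_
    intro v s t hne
    simp only [ne_eq, ite_eq_right_iff, Classical.not_imp] at hne
    obtain ⟨⟨hv, ht, h5⟩, -⟩ := hne
    have hs := hs_pos v s t hv (by omega) h5
    have hn : 0 ≤ n := by nlinarith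
    have hsn : s ≤ n := by
      nlinarith [mul_nonneg (by omega : 0 ≤ t) (by omega : 0 ≤ u - v),
        mul_nonneg hs.le (by omega : 0 ≤ u + v - 1)]
    omega
  have := finsum_add_distrib (hfin 0 le_rfl zero_le_one) (hfin 1 zero_le_one le_rfl)
  rw [finsum_window_eq_zero, finsum_window_eq_zero, add_zero] at this
  refine Eq.trans (finsum_congr fun ⟨v, s, t⟩ => ?_) this
  simp only
  by_cases hv : -u < v ∧ v < u
  swap
  · simp [hv]
  by_cases h5 : s * (u + v) + t * (u - v) = n - v ^ 2
  swap
  · simp [h5]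
  simp only [hv, h5, and_true, true_and]
  by_cases ht : 0 ≤ t ∧ t ≤ u + v
  · have hs := hs_pos v s t hv ht.2 h5
    rw [if_pos (by omega)]
    have hw : tripleWeight (u + v - t) s t =
        (if 0 ≤ t ∧ t < u + v + 0 then 2 else 0) + (if 1 ≤ t ∧ t < u + v + 1 then 2 else 0) := by
      unfold tripleWeight
      split_ifs <;> omega
    rw [hw]
    split_ifs <;> ring
  · have hw : tripleWeight (u + v - t) s t = 0 := by
      unfold tripleWeight
      split_ifs <;> omega
    rw [if_neg (c := 0 ≤ t ∧ t < u + v + 0) (by omega),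
      if_neg (c := 1 ≤ t ∧ t < u + v + 1) (by omega), hw]
    simp

/-- For fixed `u = r + j`, the terms with `|v| < u`, `v = t - j`, cancel. -/
theorem finsum_weighted_line_eq_zero (n u : ℤ) :
    ∑ᶠ p : ℤ × ℤ × ℤ, (if (-u < p.1 ∧ p.1 < u) ∧ (0 ≤ p.2.1 ∧ 0 ≤ p.2.2) ∧
      p.2.1 * (u + p.1) + p.2.2 * (u - p.1) = n - p.1 ^ 2
      then altSign (p.2.1 + p.2.2) * tripleWeight (u + p.1 - p.2.2) p.2.1 p.2.2 * p.1 else 0)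
      = 0 := by
  rcases lt_trichotomy (u ^ 2) n with h | rfl | h
  · exact finsum_weighted_line_eq_zero_of_lt h
  · exact finsum_weighted_line_eq_zero_of_eq u
  · exact finsum_weighted_line_eq_zero_of_gt h

theorem finsum_altSign_mul_tripleWeight (u s : ℤ) :
    ∑ᶠ j : ℤ, altSign j * tripleWeight (u - j) s (u + j) =
      if 0 < u ∧ s = 0 then -2 * altSign u else 0 := by
  by_cases hus : 0 < u ∧ 0 ≤ s
  swap
  · rw [if_neg (by omega), ← finsum_zero (α := ℤ)]
    refine finsum_congr fun j => ?_
    have : tripleWeight (u - j) s (u + j) = 0 := by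
      unfold tripleWeight
      split_ifs <;> omega
    rw [this, mul_zero]
  obtain ⟨hu, hs⟩ := hus
  let c : ℤ := if s = 0 then 1 else 2
  let d : ℤ := if s = 0 then -altSign u else 0
  let h : ℤ → ℤ := fun j => if -u ≤ j ∧ j < u then c else 0
  have hw : ∀ j, altSign j * tripleWeight (u - j) s (u + j) =
      ((altSign j * h j + altSign j * h (j - 1)) + (if j = u then d else 0)) +
        (if j = -u then d else 0) := by
    intro j
    have : tripleWeight (u - j) s (u + j) = h j + h (j - 1) +
        (if s = 0 ∧ j = u then -1 else 0) + (if s = 0 ∧ j = -u then -1 else 0) := by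
      unfold tripleWeight
      simp only [h, c]
      split_ifs <;> omega
    rw [this]
    simp only [d]
    by_cases h0 : s = 0
    · simp only [h0, true_and, if_true]
      by_cases h1 : j = u
      · have h2 : j ≠ -u := by omega
        simp only [h1, if_true, if_neg (h1 ▸ h2)]
        ring
      · by_cases h2 : j = -u
        · have h3 : -u ≠ u := by omega
          simp only [h2, if_true, if_neg h3, altSign_neg]
          ring
        · simp only [h1, h2, if_false]
          ring
    · simp only [h0, false_and, if_false, ite_self]
      ring
  have hfin : ∀ f : ℤ → ℤ, (∀ j, f j ≠ 0 → -u ≤ j ∧ j ≤ u) → HasFiniteSupport f := fun f hf =>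
    (finite_Icc (-u) u).subset fun j hj => hf j hj
  have f1 : HasFiniteSupport fun j => altSign j * h j := by
    refine hfin _ fun j hj => ?_
    have := right_ne_zero_of_mul hj
    simp only [h, ne_eq, ite_eq_right_iff, Classical.not_imp] at this
    omega
  have f2 : HasFiniteSupport fun j => altSign j * h (j - 1) := by
    refine hfin _ fun j hj => ?_
    have := right_ne_zero_of_mul hj
    simp only [h, ne_eq, ite_eq_right_iff, Classical.not_imp] at this
    omega
  have f12 : HasFiniteSupport fun j => altSign j * h j + altSign j * h (j - 1) := f1.add f2
  have f3 : ∀ a : ℤ, -u ≤ a → a ≤ u → HasFiniteSupport fun j : ℤ => if j = a then d else 0 := by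
    refine fun a h1 h2 => hfin _ fun j hj => ?_
    simp only [ne_eq, ite_eq_right_iff, Classical.not_imp] at hj
    omega
  have hsh : ∑ᶠ j, altSign j * h (j - 1) = -∑ᶠ j, altSign j * h j := by
    rw [← finsum_comp_equiv (Equiv.addRight (1 : ℤ)), ← finsum_neg_distrib]
    refine finsum_congr fun j => ?_
    simp only [Equiv.coe_addRight, add_sub_cancel_right, altSign_add, altSign_one]
    ring
  have hsingle : ∀ a : ℤ, ∑ᶠ j : ℤ, (if j = a then d else 0) = d := by
    intro a
    rw [finsum_eq_single _ a fun x hx => if_neg hx, if_pos rfl]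
  rw [finsum_congr hw, finsum_add_distrib (HasFiniteSupport.fun_add f12 (f3 u (by omega) le_rfl))
    (f3 (-u) le_rfl (by omega)), finsum_add_distrib f12 (f3 u (by omega) le_rfl),
    finsum_add_distrib f1 f2, hsh, hsingle, hsingle]
  simp only [d, hu, true_and]
  split_ifs <;> ring

/-- The signed weight of `(j, r, s, t)` as a solution of `j² + rs + rt + st = n`. -/
def quadWeight (n : ℤ) (p : ℤ × ℤ × ℤ × ℤ) : ℤ :=
  if p.1 ^ 2 + (p.2.1 * p.2.2.1 + p.2.1 * p.2.2.2 + p.2.2.1 * p.2.2.2) = n then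
    altSign (p.1 + p.2.1 + p.2.2.1 + p.2.2.2) * tripleWeight p.2.1 p.2.2.1 p.2.2.2 else 0

theorem quadWeight_ne_zero {n : ℤ} {p : ℤ × ℤ × ℤ × ℤ} (h : quadWeight n p ≠ 0) :
    p.1 ^ 2 + (p.2.1 * p.2.2.1 + p.2.1 * p.2.2.2 + p.2.2.1 * p.2.2.2) = n ∧
      tripleWeight p.2.1 p.2.2.1 p.2.2.2 ≠ 0 := by
  unfold quadWeight at h
  split_ifs at h with h1
  · exact ⟨h1, right_ne_zero_of_mul h⟩
  · exact absurd rfl h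

theorem hasFiniteSupport_quadWeight (n : ℤ) : HasFiniteSupport (quadWeight n) := by
  refine hasFiniteSupport_of_bound₄ _ n ?_
  intro j r s t h
  obtain ⟨h1, h2⟩ := quadWeight_ne_zero h
  obtain ⟨hr, hs, ht, hrs, hrt, hst⟩ := tripleWeight_nonneg h2
  simp only at *
  have a1 := mul_nonneg hr hs
  have a2 := mul_nonneg hr ht
  have a3 := mul_nonneg hs ht
  have b1 := mul_nonneg hr (by omega : 0 ≤ s + t - 1)
  have b2 := mul_nonneg hs (by omega : 0 ≤ r + t - 1)
  have b3 := mul_nonneg ht (by omega : 0 ≤ r + s - 1)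
  refine ⟨⟨?_, ?_⟩, ⟨?_, ?_⟩, ⟨?_, ?_⟩, ⟨?_, ?_⟩⟩ <;>
    nlinarith [sq_nonneg j, Int.le_self_sq j, Int.le_self_sq (-j)]

theorem hasFiniteSupport_quadWeight_comp_mul {α : Type*} (n : ℤ) {e : α → ℤ × ℤ × ℤ × ℤ}
    (he : Injective e) (g : α → ℤ) : HasFiniteSupport fun x => quadWeight n (e x) * g x :=
  ((hasFiniteSupport_quadWeight n).preimage he.injOn).subset fun _ hx => left_ne_zero_of_mul hx

theorem finsum_quadWeight_mul_add (n : ℤ) (f g : ℤ × ℤ × ℤ × ℤ → ℤ) :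
    ∑ᶠ p, quadWeight n p * (f p + g p) =
      ∑ᶠ p, quadWeight n p * f p + ∑ᶠ p, quadWeight n p * g p := by
  simp only [mul_add]
  exact finsum_add_distrib (hasFiniteSupport_quadWeight_comp_mul n injective_id f)
    (hasFiniteSupport_quadWeight_comp_mul n injective_id g)

theorem finsum_quadWeight_mul_comp (n : ℤ) (e : ℤ × ℤ × ℤ × ℤ → ℤ × ℤ × ℤ × ℤ)
    (he : Involutive e) (hw : ∀ p, quadWeight n (e p) = quadWeight n p)
    (g : ℤ × ℤ × ℤ × ℤ → ℤ) :
    ∑ᶠ p, quadWeight n p * g (e p) = ∑ᶠ p, quadWeight n p * g p := by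
  rw [← finsum_comp_equiv he.toPerm (f := fun p => quadWeight n p * g p)]
  refine finsum_congr fun p => ?_
  simp [hw]

theorem quadWeight_swap_right (n j r s t : ℤ) :
    quadWeight n (j, r, t, s) = quadWeight n (j, r, s, t) := by
  unfold quadWeight
  simp only [tripleWeight_swap_right r t s]
  ring_nf

theorem quadWeight_swap_left (n j r s t : ℤ) :
    quadWeight n (j, s, r, t) = quadWeight n (j, r, s, t) := by
  unfold quadWeight
  simp only [tripleWeight_swap_left s r t]
  ring_nf

theorem quadWeight_neg (n j r s t : ℤ) :
    quadWeight n (-j, r, s, t) = quadWeight n (j, r, s, t) := by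
  unfold quadWeight
  simp only [neg_sq, altSign_add, altSign_neg]

theorem quadWeight_reverse (n j r s t : ℤ) :
    quadWeight n (-j, t, s, r) = quadWeight n (j, r, s, t) := by
  rw [quadWeight_neg, quadWeight_swap_right, quadWeight_swap_left, quadWeight_swap_right]

theorem finsum_quadWeight_offdiag (n : ℤ) :
    ∑ᶠ p : ℤ × ℤ × ℤ × ℤ, quadWeight n p * (if p.2.2.2 - p.1 < p.2.1 + p.1 then
      (p.2.1 + p.1) * (p.2.2.2 - p.1) else 0) = 0 := by
  let e : ℤ × ℤ × ℤ × ℤ ≃ ℤ × ℤ × ℤ × ℤ :=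
    { toFun := fun p => (p.2.2.2 - p.2.1, p.1 + p.2.1 - p.2.2.2, p.2.2.1, p.2.2.2)
      invFun := fun p => (p.2.1 + p.1, p.2.2.2 - p.1, p.2.2.1, p.2.2.2)
      left_inv := fun p => by ext <;> simp
      right_inv := fun p => by ext <;> simp }
  rw [← finsum_comp_equiv e, finsum_curry]
  swap
  · exact hasFiniteSupport_quadWeight_comp_mul n e.injective _
  refine Eq.trans (finsum_congr (g := fun _ => 0) fun u => ?_) finsum_zero
  have hu : altSign u * u * _ = 0 :=
    mul_eq_zero_of_right _ (finsum_weighted_line_eq_zero n u)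
  rw [mul_finsum] at hu
  refine Eq.trans (finsum_congr fun ⟨v, s, t⟩ => ?_) hu
  simp only [e, Equiv.coe_fn_mk, quadWeight]
  by_cases hw : tripleWeight (u + v - t) s t = 0
  · simp [hw]
  obtain ⟨hr, hs, ht, hrs, hrt, hst⟩ := tripleWeight_nonneg hw
  have hl : (t - v) ^ 2 + ((u + v - t) * s + (u + v - t) * t + s * t) = n ↔
      s * (u + v) + t * (u - v) = n - v ^ 2 := by
    constructor <;> intro h <;> linear_combination h
  simp only [hl, hs, ht, and_true, true_and]
  by_cases h5 : s * (u + v) + t * (u - v) = n - v ^ 2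
  swap
  · simp [h5]
  simp only [h5, and_true, if_true]
  by_cases hv : v < u
  · rw [if_pos (by omega), if_pos (by omega),
      show t - v + (u + v - t) + s + t = u + (s + t) by ring, altSign_add u]
    ring
  · rw [if_neg (by omega), if_neg (by omega)]
    ring

theorem finsum_quadWeight_diag (n : ℤ) :
    ∑ᶠ p : ℤ × ℤ × ℤ × ℤ, quadWeight n p * (if p.2.2.2 - p.1 = p.2.1 + p.1 then
      (p.2.1 + p.1) * (p.2.2.2 - p.1) else 0) =
    -2 * n * ∑ᶠ u : ℤ, if 0 < u ∧ u ^ 2 = n then altSign u else 0 := by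
  have hg : Injective fun q : ℤ × ℤ × ℤ => (q.2.2, q.1 - q.2.2, q.2.1, q.1 + q.2.2) := by
    rintro ⟨u, s, j⟩ ⟨u', s', j'⟩ h
    simp only [Prod.mk.injEq] at h ⊢
    omega
  rw [finsum_comp_of_injective _ hg, finsum_curry₃, mul_finsum]
  rotate_left
  · exact hasFiniteSupport_quadWeight_comp_mul n hg _
  · rintro ⟨j, r, s, t⟩ h
    have := right_ne_zero_of_mul h
    simp only [ne_eq, ite_eq_right_iff, Classical.not_imp] at this
    refine ⟨(r + j, s, j), ?_⟩
    ext <;> simp only <;> omega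
  refine finsum_congr fun u => ?_
  have hj : ∀ s : ℤ, (∑ᶠ j : ℤ, quadWeight n (j, u - j, s, u + j) *
      (if u + j - j = u - j + j then (u - j + j) * (u + j - j) else 0)) =
      (if u ^ 2 + 2 * u * s = n then u ^ 2 * altSign s else 0) *
        (if 0 < u ∧ s = 0 then -2 * altSign u else 0) := by
    intro s
    rw [← finsum_altSign_mul_tripleWeight, mul_finsum]
    refine finsum_congr fun j => ?_
    have hl : j ^ 2 + ((u - j) * s + (u - j) * (u + j) + s * (u + j)) = u ^ 2 + 2 * u * s := by
      ring
    have ha : altSign (j + (u - j) + s + (u + j)) = altSign s * altSign j := by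
      rw [← altSign_add]
      exact altSign_congr ⟨u, by ring⟩
    simp only [quadWeight, hl, ha, add_sub_cancel_right, sub_add_cancel, if_true]
    split_ifs <;> ring
  simp only [hj]
  rw [finsum_eq_single _ 0]
  · by_cases h1 : u ^ 2 = n
    · by_cases h2 : 0 < u
      · simp [h1, h2, altSign]
        split_ifs <;> ring
      · simp [h2]
    · simp [h1]
  · intro s hs
    simp [hs]

theorem finsum_quadWeight_mul (n : ℤ) :
    ∑ᶠ p : ℤ × ℤ × ℤ × ℤ, quadWeight n p * ((p.2.1 + p.1) * (p.2.2.2 - p.1)) =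
    -2 * n * ∑ᶠ u : ℤ, if 0 < u ∧ u ^ 2 = n then altSign u else 0 := by
  have hlt : ∑ᶠ p : ℤ × ℤ × ℤ × ℤ, quadWeight n p * (if p.2.1 + p.1 < p.2.2.2 - p.1 then
      (p.2.1 + p.1) * (p.2.2.2 - p.1) else 0) = 0 := by
    refine Eq.trans ?_ (finsum_quadWeight_offdiag n)
    rw [← finsum_quadWeight_mul_comp n
      (fun p => (-p.1, p.2.2.2, p.2.2.1, p.2.1)) (fun p => by simp)
      fun p => quadWeight_reverse n _ _ _ _]
    refine finsum_congr fun p => ?_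
    simp only [sub_neg_eq_add, ← sub_eq_add_neg]
    rw [mul_comm (p.2.1 + p.1)]
  have h := congrArg₂ (· + ·) (congrArg₂ (· + ·) (finsum_quadWeight_diag n) hlt)
    (finsum_quadWeight_offdiag n)
  simp only [← finsum_quadWeight_mul_add, add_zero] at h
  refine Eq.trans (finsum_congr fun p => ?_) h
  rcases lt_trichotomy (p.2.2.2 - p.1) (p.2.1 + p.1) with h | h | h
  · simp only [h, h.ne, h.not_gt, if_true, if_false, zero_add]
  · simp only [h, lt_irrefl, if_true, if_false, add_zero]
  · simp only [h, h.ne', h.not_gt, if_true, if_false, zero_add, add_zero]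

theorem finsum_quadWeight_mul_sub (n : ℤ) :
    ∑ᶠ p : ℤ × ℤ × ℤ × ℤ, quadWeight n p * (n - 4 * p.1 ^ 2) =
    -6 * n * ∑ᶠ u : ℤ, if 0 < u ∧ u ^ 2 = n then altSign u else 0 := by
  have h1 : ∑ᶠ p, quadWeight n p * (p.2.1 * p.2.2.1) =
      ∑ᶠ p, quadWeight n p * (p.2.1 * p.2.2.2) :=
    finsum_quadWeight_mul_comp n (fun p => (p.1, p.2.1, p.2.2.2, p.2.2.1)) (fun p => by simp)
      (fun p => quadWeight_swap_right n _ _ _ _) fun p => p.2.1 * p.2.2.2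
  have h2 : ∑ᶠ p, quadWeight n p * (p.2.2.1 * p.2.2.2) =
      ∑ᶠ p, quadWeight n p * (p.2.1 * p.2.2.2) :=
    finsum_quadWeight_mul_comp n (fun p => (p.1, p.2.2.1, p.2.1, p.2.2.2)) (fun p => by simp)
      (fun p => quadWeight_swap_left n _ _ _ _) fun p => p.2.1 * p.2.2.2
  have h3 : ∑ᶠ p, quadWeight n p * (p.1 * (p.2.2.2 - p.2.1)) = 0 := by
    have h := finsum_quadWeight_mul_comp n (fun p => (-p.1, p.2)) (fun p => by simp)
      (fun p => quadWeight_neg n _ _ _ _) fun p => p.1 * (p.2.2.2 - p.2.1)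
    simp only [neg_mul, mul_neg, finsum_neg_distrib] at h
    omega
  have h4 := finsum_quadWeight_mul n
  have hsum : ∀ p, quadWeight n p * (n - 4 * p.1 ^ 2) = quadWeight n p *
      ((p.2.1 * p.2.2.1 + p.2.2.1 * p.2.2.2) + (-2 * (p.2.1 * p.2.2.2) +
        (3 * ((p.2.1 + p.1) * (p.2.2.2 - p.1)) + -3 * (p.1 * (p.2.2.2 - p.2.1))))) := by
    intro p
    by_cases hp : quadWeight n p = 0
    · rw [hp, zero_mul, zero_mul]
    · rw [← (quadWeight_ne_zero hp).1]
      ring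
  have hc : ∀ (c : ℤ) (g : ℤ × ℤ × ℤ × ℤ → ℤ),
      ∑ᶠ p, quadWeight n p * (c * g p) = c * ∑ᶠ p, quadWeight n p * g p := by
    intro c g
    rw [mul_finsum]
    exact finsum_congr fun p => by ring
  rw [finsum_congr hsum, finsum_quadWeight_mul_add, finsum_quadWeight_mul_add,
    finsum_quadWeight_mul_add, finsum_quadWeight_mul_add, hc, hc, hc, h1, h2, h3, h4]
  ring

/-- The number of representations of an integer as a sum of three squares. -/
noncomputable def threeSquares (n : ℤ) : ℤ :=
  ∑ᶠ v : ℤ × ℤ × ℤ, if v.1 ^ 2 + v.2.1 ^ 2 + v.2.2 ^ 2 = n then 1 else 0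

/-- The signed weighted number of triples with `rs + rt + st = n`. -/
noncomputable def tripleSum (n : ℤ) : ℤ :=
  ∑ᶠ p : ℤ × ℤ × ℤ, if p.1 * p.2.1 + p.1 * p.2.2 + p.2.1 * p.2.2 = n then
    altSign (p.1 + p.2.1 + p.2.2) * tripleWeight p.1 p.2.1 p.2.2 else 0

theorem finsum_tripleSum (n : ℤ) :
    ∑ᶠ j : ℤ, altSign j * (n - 4 * j ^ 2) * tripleSum (n - j ^ 2) =
    -6 * n * ∑ᶠ u : ℤ, if 0 < u ∧ u ^ 2 = n then altSign u else 0 := by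
  rw [← finsum_quadWeight_mul_sub, finsum_curry]
  swap
  · exact hasFiniteSupport_quadWeight_comp_mul n injective_id _
  refine finsum_congr fun j => ?_
  rw [tripleSum, mul_finsum]
  refine finsum_congr fun ⟨r, s, t⟩ => ?_
  have hl : j ^ 2 + (r * s + r * t + s * t) = n ↔ r * s + r * t + s * t = n - j ^ 2 := by
    constructor <;> intro h <;> linarith
  simp only [quadWeight, hl, add_assoc j, altSign_add j]
  split_ifs <;> ring

theorem hasFiniteSupport_fourSquares (n : ℤ) (g : ℤ × ℤ × ℤ × ℤ → ℤ) :
    HasFiniteSupport fun p : ℤ × ℤ × ℤ × ℤ =>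
      if p.1 ^ 2 + (p.2.1 ^ 2 + p.2.2.1 ^ 2 + p.2.2.2 ^ 2) = n then g p else 0 := by
  refine hasFiniteSupport_of_bound₄ _ n ?_
  intro w x y z h
  simp only [ne_eq, ite_eq_right_iff, Classical.not_imp] at h
  have h1 := h.1
  refine ⟨⟨?_, ?_⟩, ⟨?_, ?_⟩, ⟨?_, ?_⟩, ⟨?_, ?_⟩⟩ <;>
    nlinarith [sq_nonneg w, sq_nonneg x, sq_nonneg y, sq_nonneg z, Int.le_self_sq w,
      Int.le_self_sq x, Int.le_self_sq y, Int.le_self_sq z, Int.le_self_sq (-w),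
      Int.le_self_sq (-x), Int.le_self_sq (-y), Int.le_self_sq (-z)]

theorem finsum_threeSquares (n : ℤ) :
    ∑ᶠ j : ℤ, (n - 4 * j ^ 2) * threeSquares (n - j ^ 2) = 0 := by
  let S : (ℤ × ℤ × ℤ × ℤ → ℤ) → ℤ := fun g => ∑ᶠ p : ℤ × ℤ × ℤ × ℤ,
    if p.1 ^ 2 + (p.2.1 ^ 2 + p.2.2.1 ^ 2 + p.2.2.2 ^ 2) = n then g p else 0
  have hadd : ∀ f g, S (fun p => f p + g p) = S f + S g := by
    intro f g
    simp only [S]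
    rw [← finsum_add_distrib (hasFiniteSupport_fourSquares n f) (hasFiniteSupport_fourSquares n g)]
    refine finsum_congr fun p => ?_
    split_ifs <;> simp
  have hneg : ∀ g, S (fun p => -3 * g p) = -3 * S g := by
    intro g
    simp only [S]
    rw [mul_finsum]
    refine finsum_congr fun p => ?_
    split_ifs <;> simp
  have hcomp : ∀ (e : ℤ × ℤ × ℤ × ℤ → ℤ × ℤ × ℤ × ℤ), Involutive e →
      (∀ p, (e p).1 ^ 2 + ((e p).2.1 ^ 2 + (e p).2.2.1 ^ 2 + (e p).2.2.2 ^ 2) =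
        p.1 ^ 2 + (p.2.1 ^ 2 + p.2.2.1 ^ 2 + p.2.2.2 ^ 2)) →
      ∀ g, S (fun p => g (e p)) = S g := by
    intro e he hq g
    simp only [S]
    rw [← finsum_comp_equiv he.toPerm (f := fun p : ℤ × ℤ × ℤ × ℤ =>
      if p.1 ^ 2 + (p.2.1 ^ 2 + p.2.2.1 ^ 2 + p.2.2.2 ^ 2) = n then g p else 0)]
    refine finsum_congr fun p => ?_
    simp only [Involutive.coe_toPerm, hq]
  have h1 : S (fun p => p.2.1 ^ 2) = S fun p => p.1 ^ 2 :=
    hcomp (fun p => (p.2.1, p.1, p.2.2)) (fun p => rfl) (fun p => by ring) fun p => p.1 ^ 2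
  have h2 : S (fun p => p.2.2.1 ^ 2) = S fun p => p.1 ^ 2 :=
    hcomp (fun p => (p.2.2.1, p.2.1, p.1, p.2.2.2)) (fun p => rfl) (fun p => by ring)
      fun p => p.1 ^ 2
  have h3 : S (fun p => p.2.2.2 ^ 2) = S fun p => p.1 ^ 2 :=
    hcomp (fun p => (p.2.2.2, p.2.1, p.2.2.1, p.1)) (fun p => rfl) (fun p => by ring)
      fun p => p.1 ^ 2
  have h4 : S (fun p => p.2.1 ^ 2 + (p.2.2.1 ^ 2 + (p.2.2.2 ^ 2 + -3 * p.1 ^ 2))) = 0 := by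
    rw [hadd, hadd, hadd, hneg, h1, h2, h3]
    ring
  rw [← h4]
  simp only [S]
  rw [finsum_curry _ (hasFiniteSupport_fourSquares n _)]
  refine finsum_congr fun j => ?_
  rw [threeSquares, mul_finsum]
  refine finsum_congr fun ⟨x, y, z⟩ => ?_
  have hl : j ^ 2 + (x ^ 2 + y ^ 2 + z ^ 2) = n ↔ x ^ 2 + y ^ 2 + z ^ 2 = n - j ^ 2 := by
    constructor <;> intro h <;> linarith
  simp only [hl]
  split_ifs with h
  · linear_combination -h
  · simp

theorem threeSquares_of_neg {n : ℤ} (hn : n < 0) : threeSquares n = 0 := by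
  rw [threeSquares]
  refine Eq.trans (finsum_congr (g := fun _ => 0) fun v => if_neg ?_) finsum_zero
  nlinarith [sq_nonneg v.1, sq_nonneg v.2.1, sq_nonneg v.2.2]

theorem threeSquares_zero : threeSquares 0 = 1 := by
  rw [threeSquares, finsum_eq_single _ (0, 0, 0)]
  · simp
  · rintro ⟨x, y, z⟩ h
    refine if_neg fun h0 => h ?_
    simp only at h0
    have hx : x ^ 2 = 0 := by nlinarith [sq_nonneg x, sq_nonneg y, sq_nonneg z]
    have hy : y ^ 2 = 0 := by nlinarith [sq_nonneg x, sq_nonneg y, sq_nonneg z]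
    have hz : z ^ 2 = 0 := by nlinarith [sq_nonneg x, sq_nonneg y, sq_nonneg z]
    rw [pow_eq_zero_iff two_ne_zero] at hx hy hz
    rw [hx, hy, hz]

theorem tripleSum_of_nonpos {n : ℤ} (hn : n ≤ 0) : tripleSum n = 0 := by
  rw [tripleSum]
  refine Eq.trans (finsum_congr (g := fun _ => 0) fun ⟨r, s, t⟩ => ?_) finsum_zero
  simp only
  split_ifs with h
  · by_cases hw : tripleWeight r s t = 0
    · rw [hw, mul_zero]
    · obtain ⟨hr, hs, ht, hrs, hrt, hst⟩ := tripleWeight_nonneg hw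
      exfalso
      have a1 := mul_nonneg hr hs
      have a2 := mul_nonneg hr ht
      have a3 := mul_nonneg hs ht
      rcases hr.eq_or_lt with rfl | hr
      · nlinarith [mul_pos (by omega : 0 < s) (by omega : 0 < t)]
      · nlinarith [mul_pos hr hst]
  · rfl

/-- The difference of the two sides of the three squares formula. -/
noncomputable def threeSquaresDefect (n : ℤ) : ℤ := altSign n * threeSquares n + tripleSum n

theorem finsum_threeSquaresDefect (n : ℤ) :
    ∑ᶠ j : ℤ, altSign j * (n - 4 * j ^ 2) * threeSquaresDefect (n - j ^ 2) =
    -6 * n * ∑ᶠ u : ℤ, if 0 < u ∧ u ^ 2 = n then altSign u else 0 := by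
  have hfin : ∀ f : ℤ → ℤ, (∀ m, m < 0 → f m = 0) → ∀ g : ℤ → ℤ,
      HasFiniteSupport fun j => g j * f (n - j ^ 2) := by
    intro f hf g
    refine (finite_Icc (-n) n).subset fun j hj => ?_
    have h1 : ¬ n - j ^ 2 < 0 := fun h => right_ne_zero_of_mul hj (hf _ h)
    constructor <;> nlinarith [Int.le_self_sq j, Int.le_self_sq (-j)]
  have h : ∀ j : ℤ, altSign j * (n - 4 * j ^ 2) * threeSquaresDefect (n - j ^ 2) =
      altSign n * (n - 4 * j ^ 2) * threeSquares (n - j ^ 2) +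
        altSign j * (n - 4 * j ^ 2) * tripleSum (n - j ^ 2) := by
    intro j
    have ha : altSign j * altSign (n - j ^ 2) = altSign n := by
      rw [← altSign_sq j, ← altSign_add, add_sub_cancel]
    rw [threeSquaresDefect, ← ha]
    ring
  rw [finsum_congr h, finsum_add_distrib
    (hfin _ (fun m hm => threeSquares_of_neg hm) fun j => altSign n * (n - 4 * j ^ 2))
    (hfin _ (fun m hm => tripleSum_of_nonpos hm.le) fun j => altSign j * (n - 4 * j ^ 2)),
    finsum_tripleSum]
  simp only [mul_assoc (altSign n), ← mul_finsum]
  rw [finsum_threeSquares]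
  ring

theorem threeSquaresDefect_eq_zero {n : ℤ} (hn : 0 < n) : threeSquaresDefect n = 0 := by
  induction h : n.toNat using Nat.strong_induction_on generalizing n with
  | _ N ih =>
  have hsmall : ∀ m : ℤ, m < n → m ≠ 0 → threeSquaresDefect m = 0 := by
    intro m hm hm0
    rcases hm0.lt_or_gt with h0 | h0
    · rw [threeSquaresDefect, threeSquares_of_neg h0, tripleSum_of_nonpos h0.le]
      ring
    · exact ih m.toNat (by omega) h0 rfl
  have hzero : threeSquaresDefect 0 = 1 := by
    rw [threeSquaresDefect, threeSquares_zero, tripleSum_of_nonpos le_rfl]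
    decide
  let a : ℤ → ℤ := fun u => if 0 < u ∧ u ^ 2 = n then altSign u else 0
  have hterm : ∀ j : ℤ, altSign j * (n - 4 * j ^ 2) * threeSquaresDefect (n - j ^ 2) =
      (if j = 0 then n * threeSquaresDefect n else 0) + (-3 * n * a j + -3 * n * a (-j)) := by
    intro j
    by_cases hj : j = 0
    · subst hj
      simp [a, altSign]
    · have hj2 : 0 < j ^ 2 := by positivity
      by_cases hjn : j ^ 2 = n
      · rw [if_neg hj, hjn, sub_self, hzero]
        simp only [a, neg_sq, hjn, and_true, altSign_neg]
        rcases lt_or_gt_of_ne hj with h | h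
        · rw [if_neg (by omega), if_pos (by omega)]
          ring
        · rw [if_pos (by omega), if_neg (by omega)]
          ring
      · rw [hsmall (n - j ^ 2) (by omega) (by omega)]
        simp [hj, a, hjn]
  have ha : HasFiniteSupport a := by
    refine (finite_Icc 0 n).subset fun j hj => ?_
    simp only [a, mem_support, ne_eq, ite_eq_right_iff, Classical.not_imp] at hj
    constructor <;> nlinarith
  have ha1 : HasFiniteSupport fun j => -3 * n * a j :=
    ha.subset fun j hj => right_ne_zero_of_mul hj
  have ha2 : HasFiniteSupport fun j => -3 * n * a (-j) :=
    (ha.preimage neg_injective.injOn).subset fun j hj => right_ne_zero_of_mul hj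
  have hs0 : HasFiniteSupport fun j : ℤ => if j = 0 then n * threeSquaresDefect n else 0 := by
    refine (finite_singleton (0 : ℤ)).subset fun j hj => ?_
    by_contra h
    exact hj (if_neg h)
  have hneg : ∑ᶠ j, a (-j) = ∑ᶠ j, a j := finsum_comp_equiv (Equiv.neg ℤ) (f := a)
  have key := finsum_threeSquaresDefect n
  rw [finsum_congr hterm, finsum_add_distrib hs0 (HasFiniteSupport.fun_add ha1 ha2),
    finsum_add_distrib ha1 ha2, ← mul_finsum, ← mul_finsum,
    finsum_eq_single _ 0 fun x hx => if_neg hx, if_pos rfl, hneg] at key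
  have : n * threeSquaresDefect n = 0 := by
    simp only [a] at key
    linarith
  exact (mul_eq_zero.1 this).resolve_left hn.ne'


theorem natCast_r3 (n : ℕ) : (r3 n : ℤ) = threeSquares n := by
  have hfin : {v : ℤ × ℤ × ℤ | v.1 ^ 2 + v.2.1 ^ 2 + v.2.2 ^ 2 = (n : ℤ)}.Finite := by
    refine ((finite_Icc (-n : ℤ) n).prod
      ((finite_Icc (-n : ℤ) n).prod (finite_Icc (-n : ℤ) n))).subset ?_
    rintro ⟨x, y, z⟩ h
    simp only [mem_ofPred_eq] at h
    refine ⟨⟨?_, ?_⟩, ⟨?_, ?_⟩, ⟨?_, ?_⟩⟩ <;>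
      nlinarith [sq_nonneg x, sq_nonneg y, sq_nonneg z, Int.le_self_sq x, Int.le_self_sq y,
        Int.le_self_sq z, Int.le_self_sq (-x), Int.le_self_sq (-y), Int.le_self_sq (-z)]
  rw [r3, ← finsum_one, Nat.cast_finsum_mem hfin, threeSquares]
  refine finsum_congr fun v => ?_
  by_cases h : v.1 ^ 2 + v.2.1 ^ 2 + v.2.2 ^ 2 = (n : ℤ) <;> simp [h]

theorem card_filter_odd_divisors {k m : ℕ} (hm : Odd m) :
    ((2 ^ k * m).divisors.filter Odd).card = m.divisors.card := by
  congr 1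
  ext d
  simp only [Finset.mem_filter, Nat.mem_divisors]
  have hm0 : m ≠ 0 := by rintro rfl; simp at hm
  constructor
  · rintro ⟨⟨h1, -⟩, h2⟩
    exact ⟨(Nat.Coprime.pow_right k (Nat.coprime_two_right.2 h2)).dvd_of_dvd_mul_left h1, hm0⟩
  · rintro ⟨h1, -⟩
    exact ⟨⟨h1.mul_left _, by positivity⟩, hm.of_dvd_nat h1⟩

theorem sum_divisorsAntidiagonal_sign {k m : ℕ} (hk : k ≠ 0) (hm : Odd m) :
    ∑ x ∈ (2 ^ k * m).divisorsAntidiagonal, (-1 : ℤ) ^ (x.1 + x.2) =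
      (k - 3) * m.divisors.card := by
  have hterm : ∀ x ∈ (2 ^ k * m).divisorsAntidiagonal, (-1 : ℤ) ^ (x.1 + x.2) =
      1 - 2 * (if Odd x.1 then 1 else 0) - 2 * (if Odd x.2 then 1 else 0) := by
    rintro ⟨a, b⟩ hx
    have h : Even (a * b) := by
      rw [(Nat.mem_divisorsAntidiagonal.1 hx).1]
      exact ((Nat.even_pow.2 ⟨even_two, hk⟩).mul_right m)
    simp only [pow_add]
    rcases Nat.even_or_odd a with ha | ha <;> rcases Nat.even_or_odd b with hb | hb
    · simp [ha, hb, Nat.not_odd_iff_even.2]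
    · simp [ha, hb, Nat.not_odd_iff_even.2]
    · simp [ha, hb, Nat.not_odd_iff_even.2]
    · exact absurd h (Nat.not_even_iff_odd.2 (ha.mul hb))
  have hcard : (2 ^ k * m).divisors.card = (k + 1) * m.divisors.card := by
    rw [Nat.Coprime.card_divisors_mul, Nat.divisors_prime_pow Nat.prime_two]
    · simp
    · exact Nat.Coprime.pow_left k (Nat.coprime_two_left.2 hm)
  have hodd : ∑ d ∈ (2 ^ k * m).divisors, (if Odd d then 1 else 0 : ℤ) = m.divisors.card := by
    rw [Finset.sum_boole, card_filter_odd_divisors hm]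
  rw [Finset.sum_congr rfl hterm, Finset.sum_sub_distrib, Finset.sum_sub_distrib,
    ← Finset.mul_sum, ← Finset.mul_sum,
    Nat.sum_divisorsAntidiagonal (fun d _ => (if Odd d then 1 else 0 : ℤ)),
    Nat.sum_divisorsAntidiagonal' (fun _ d => (if Odd d then 1 else 0 : ℤ)),
    Nat.sum_divisorsAntidiagonal (fun _ _ => (1 : ℤ)), hodd, Finset.sum_const, hcard]
  push_cast [nsmul_eq_mul]
  ring

theorem finsum_pos_pairs (n : ℕ) (hn : 0 < n) :
    ∑ᶠ p : ℤ × ℤ × ℤ, (if p.1 = 0 ∧ 0 < p.2.1 ∧ 0 < p.2.2 ∧ p.2.1 * p.2.2 = n then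
      altSign (p.2.1 + p.2.2) else 0) =
    ∑ x ∈ n.divisorsAntidiagonal, (-1 : ℤ) ^ (x.1 + x.2) := by
  rw [finsum_comp_of_injective (fun x : ℕ × ℕ => ((0 : ℤ), (x.1 : ℤ), (x.2 : ℤ)))]
  · rw [← finsum_mem_coe_finset]
    refine finsum_congr fun ⟨a, b⟩ => ?_
    have h : (0 < (a : ℤ) ∧ 0 < (b : ℤ) ∧ (a : ℤ) * b = n) ↔
        (a, b) ∈ n.divisorsAntidiagonal := by
      rw [Nat.mem_divisorsAntidiagonal]
      constructor
      · rintro ⟨-, -, h⟩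
        exact ⟨by exact_mod_cast h, hn.ne'⟩
      · rintro ⟨rfl, -⟩
        have ha := Nat.pos_of_mul_pos_right hn
        have hb := Nat.pos_of_mul_pos_left hn
        exact ⟨by exact_mod_cast ha, by exact_mod_cast hb, by push_cast; rfl⟩
    simp only [true_and, h, ← Nat.cast_add, altSign_natCast, Finset.mem_coe]
    by_cases hx : (a, b) ∈ n.divisorsAntidiagonal <;> simp [hx]
  · rintro ⟨a, b⟩ ⟨c, d⟩ h
    simpa using h
  · rintro ⟨x, y, z⟩ h
    simp only [ne_eq, ite_eq_right_iff, Classical.not_imp] at h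
    obtain ⟨⟨h1, h2, h3, -⟩, -⟩ := h
    exact ⟨(y.toNat, z.toNat), by simp [h1, h2.le, h3.le]⟩

theorem finsum_pos_triples (n : ℕ) :
    ∑ᶠ p : ℤ × ℤ × ℤ, (if 0 < p.1 ∧ 0 < p.2.1 ∧ 0 < p.2.2 ∧
      p.1 * p.2.1 + p.1 * p.2.2 + p.2.1 * p.2.2 = n then
      altSign (p.1 + p.2.1 + p.2.2) else 0) =
    ∑ᶠ p ∈ {p : ℕ × ℕ × ℕ | 1 ≤ p.1 ∧ 1 ≤ p.2.1 ∧ 1 ≤ p.2.2 ∧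
      p.1 * p.2.1 + p.1 * p.2.2 + p.2.1 * p.2.2 = n}, (-1 : ℤ) ^ (p.1 + p.2.1 + p.2.2) := by
  rw [finsum_comp_of_injective
    (fun x : ℕ × ℕ × ℕ => ((x.1 : ℤ), (x.2.1 : ℤ), (x.2.2 : ℤ)))]
  · refine finsum_congr fun ⟨a, b, c⟩ => ?_
    have h : (0 < (a : ℤ) ∧ 0 < (b : ℤ) ∧ 0 < (c : ℤ) ∧ (a : ℤ) * b + a * c + b * c = n) ↔
        1 ≤ a ∧ 1 ≤ b ∧ 1 ≤ c ∧ a * b + a * c + b * c = n := by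
      norm_cast
    simp only [h, ← Nat.cast_add, altSign_natCast, mem_ofPred_eq]
    by_cases hx : 1 ≤ a ∧ 1 ≤ b ∧ 1 ≤ c ∧ a * b + a * c + b * c = n <;> simp [hx]
  · rintro ⟨a, b, c⟩ ⟨d, e, f⟩ h
    simpa using h
  · rintro ⟨x, y, z⟩ h
    simp only [ne_eq, ite_eq_right_iff, Classical.not_imp] at h
    obtain ⟨⟨h1, h2, h3, -⟩, -⟩ := h
    exact ⟨(x.toNat, y.toNat, z.toNat), by simp [h1.le, h2.le, h3.le]⟩

theorem tripleSum_natCast (n : ℕ) (hn : 0 < n) : tripleSum n =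
    4 * (∑ᶠ p ∈ {p : ℕ × ℕ × ℕ | 1 ≤ p.1 ∧ 1 ≤ p.2.1 ∧ 1 ≤ p.2.2 ∧
      p.1 * p.2.1 + p.1 * p.2.2 + p.2.1 * p.2.2 = n}, (-1 : ℤ) ^ (p.1 + p.2.1 + p.2.2)) +
    6 * ∑ x ∈ n.divisorsAntidiagonal, (-1 : ℤ) ^ (x.1 + x.2) := by
  rw [← finsum_pos_triples, ← finsum_pos_pairs n hn]
  let A : ℤ × ℤ × ℤ → ℤ := fun p => if 0 < p.1 ∧ 0 < p.2.1 ∧ 0 < p.2.2 ∧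
      p.1 * p.2.1 + p.1 * p.2.2 + p.2.1 * p.2.2 = n then altSign (p.1 + p.2.1 + p.2.2) else 0
  let B : ℤ × ℤ × ℤ → ℤ := fun p => if p.1 = 0 ∧ 0 < p.2.1 ∧ 0 < p.2.2 ∧ p.2.1 * p.2.2 = n then
      altSign (p.2.1 + p.2.2) else 0
  let e : ℤ × ℤ × ℤ → ℤ × ℤ × ℤ := fun p => (p.2.1, p.1, p.2.2)
  let e' : ℤ × ℤ × ℤ → ℤ × ℤ × ℤ := fun p => (p.2.2, p.2.1, p.1)
  have he : Involutive e := fun p => rfl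
  have he' : Involutive e' := fun p => rfl
  have hA : HasFiniteSupport A := by
    refine hasFiniteSupport_of_bound₃ _ n ?_
    intro x y z h
    simp only [A, ne_eq, ite_eq_right_iff, Classical.not_imp] at h
    obtain ⟨⟨hx, hy, hz, h⟩, -⟩ := h
    have h1 := mul_pos hx hy
    have h2 := mul_pos hx hz
    have h3 := mul_pos hy hz
    refine ⟨⟨?_, ?_⟩, ⟨?_, ?_⟩, ⟨?_, ?_⟩⟩ <;> nlinarith
  have hB : HasFiniteSupport B := by
    refine hasFiniteSupport_of_bound₃ _ n ?_
    intro x y z h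
    simp only [B, ne_eq, ite_eq_right_iff, Classical.not_imp] at h
    obtain ⟨⟨hx, hy, hz, h⟩, -⟩ := h
    refine ⟨⟨?_, ?_⟩, ⟨?_, ?_⟩, ⟨?_, ?_⟩⟩ <;> nlinarith
  have hterm : ∀ p : ℤ × ℤ × ℤ, (if p.1 * p.2.1 + p.1 * p.2.2 + p.2.1 * p.2.2 = n then
      altSign (p.1 + p.2.1 + p.2.2) * tripleWeight p.1 p.2.1 p.2.2 else 0) =
      4 * A p + (2 * B p + (2 * B (e p) + 2 * B (e' p))) := by
    rintro ⟨x, y, z⟩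
    simp only [A, B, e, e']
    by_cases hpos : 0 < x ∧ 0 < y ∧ 0 < z
    · obtain ⟨hx, hy, hz⟩ := hpos
      simp [tripleWeight, hx, hy, hz, hx.ne', hy.ne', hz.ne', mul_comm]
    by_cases hx : x = 0 ∧ 0 < y ∧ 0 < z
    · obtain ⟨rfl, hy, hz⟩ := hx
      simp [tripleWeight, hy, hz, hy.le, hz.le, hy.ne', hz.ne', add_pos hy hz, mul_comm]
    by_cases hy : y = 0 ∧ 0 < x ∧ 0 < z
    · obtain ⟨rfl, hx, hz⟩ := hy
      simp [tripleWeight, hx, hz, hx.le, hz.le, hx.ne', hz.ne', add_pos hx hz, mul_comm]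
    by_cases hz : z = 0 ∧ 0 < x ∧ 0 < y
    · obtain ⟨rfl, hx, hy⟩ := hz
      simp [tripleWeight, hx, hy, hx.le, hy.le, hx.ne', hy.ne', add_pos hx hy, add_comm, mul_comm]
    have hw : tripleWeight x y z = 0 := by
      by_contra h
      have := tripleWeight_nonneg h
      omega
    rw [hw, mul_zero, ite_self, if_neg (by tauto), if_neg (by tauto), if_neg (by tauto),
      if_neg (by tauto)]
    simp
  have hB2 : HasFiniteSupport fun p => 2 * B p := hB.subset fun p hp => right_ne_zero_of_mul hp
  have hBe : HasFiniteSupport fun p => 2 * B (e p) :=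
    (hB.preimage he.injective.injOn).subset fun p hp => right_ne_zero_of_mul hp
  have hBe' : HasFiniteSupport fun p => 2 * B (e' p) :=
    (hB.preimage he'.injective.injOn).subset fun p hp => right_ne_zero_of_mul hp
  have h1 : ∑ᶠ p, B (e p) = ∑ᶠ p, B p := finsum_comp_equiv he.toPerm (f := B)
  have h2 : ∑ᶠ p, B (e' p) = ∑ᶠ p, B p := finsum_comp_equiv he'.toPerm (f := B)
  rw [tripleSum, finsum_congr hterm,
    finsum_add_distrib (hA.subset fun p hp => right_ne_zero_of_mul hp)
      (HasFiniteSupport.fun_add hB2 (HasFiniteSupport.fun_add hBe hBe')),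
    finsum_add_distrib hB2 (HasFiniteSupport.fun_add hBe hBe'), finsum_add_distrib hBe hBe']
  simp only [← mul_finsum, h1, h2]
  simp only [A, B]
  ring

end

/-- Corollary 6.4: for even positive `n` with `k` maximal such that `2ᵏ ∣ n`,
`r₃(n) = 6 (3 − k) d(n/2ᵏ) − 4 Σ_{rs+rt+st = n} (−1)^{r+s+t}`, the sum over ordered
triples of positive integers. -/
theorem r3_even (n k : ℕ) (hn : 0 < n) (heven : Even n)
    (hk : 2 ^ k ∣ n) (hk' : ¬ 2 ^ (k + 1) ∣ n) :
    (r3 n : ℤ) = 6 * (3 - (k : ℤ)) * (n / 2 ^ k).divisors.card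
      - 4 * ∑ᶠ p ∈ {p : ℕ × ℕ × ℕ | 1 ≤ p.1 ∧ 1 ≤ p.2.1 ∧ 1 ≤ p.2.2 ∧
          p.1 * p.2.1 + p.1 * p.2.2 + p.2.1 * p.2.2 = n},
          (-1 : ℤ) ^ (p.1 + p.2.1 + p.2.2) := by
  have h0 := threeSquaresDefect_eq_zero (n := n) (by exact_mod_cast hn)
  obtain ⟨m, hm⟩ := hk
  have hmodd : Odd m := by
    rw [← Nat.not_even_iff_odd]
    rintro ⟨c, rfl⟩
    exact hk' ⟨c, by rw [hm]; ring⟩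
  have hk0 : k ≠ 0 := by
    rintro rfl
    rw [hm, pow_zero, one_mul] at heven
    exact Nat.not_even_iff_odd.2 hmodd heven
  have hdiv : n / 2 ^ k = m := by rw [hm, Nat.mul_div_cancel_left _ (by positivity)]
  have hsign : altSign (n : ℤ) = 1 := by rw [altSign_natCast, heven.neg_one_pow]
  have hsum : ∑ x ∈ n.divisorsAntidiagonal, (-1 : ℤ) ^ (x.1 + x.2) = (k - 3) * m.divisors.card := by
    rw [hm, sum_divisorsAntidiagonal_sign hk0 hmodd]
  rw [threeSquaresDefect, hsign, tripleSum_natCast n hn, hsum, ← natCast_r3] at h0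
  rw [hdiv]
  linarith
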